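/- Under the AOD algorithm with horizon T (losses valued in [0,1], convex, G-Lipschitz gradients, domain diameter at most D), the strongly adaptive regret of the sequence w_1,…,w_T played by AOD satisfies, for every 1 ≤ τ ≤ T, SAReg(T,τ) ≤ 8·( √(3·c(T)) + DG )·√τ, where c(T) = 1 + ln T + ln(1 + log₂ T) + ln( (5 + 3 ln(1+T))/2 ). -/

import Mathlib

/-- The AdaNormalHedge potential `Φ(R,C) = exp([R]₊²/(3C))` (with `Φ(R,0) = 1`,
matching `Φ(0,0) = 1`, since `x/0 = 0` in Lean). -/
noncomputable def anhPot (R C : ℝ) : ℝ := Real.exp (max R 0 ^ 2 / (3 * C))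

/-- The AdaNormalHedge weight function `w(R,C) = (Φ(R+1,C+1) − Φ(R−1,C+1))/2`. -/
noncomputable def anhW (R C : ℝ) : ℝ := (anhPot (R + 1) (C + 1) - anhPot (R - 1) (C + 1)) / 2

/-- The starting round `(i−1)·2^k + 1` of the interval of the dense geometric covering
level `D_k` that contains round `t ≥ 1`. -/
def dgcStart (k t : ℕ) : ℕ := (t - 1) / 2 ^ k * 2 ^ k + 1

/-- The levels `k` with `2^k ≤ T` of the dense geometric covering collection
`D = ∪_{k ≥ 0, 2^k ≤ T} D_k`, `D_k = {[(i−1)·2^k + 1, i·2^k] : i ≥ 1}`.  At every round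
exactly one interval of each level is active, so experts are indexed by levels. -/
def dgcLevels (T : ℕ) : Finset ℕ := (Finset.range (T + 1)).filter fun k => 2 ^ k ≤ T

/-- `R_{t−1,I} = Σ_{u=min I}^{t−1} (f_u(w_u) − f_u(w_{u,I}))` for the active level-`k`
expert at round `t` (whose interval starts at `dgcStart k t`); `x k u` is the action of
the level-`k` expert at round `u`. -/
noncomputable def aodMetaR {α : Type*} (f : ℕ → α → ℝ) (w : ℕ → α) (x : ℕ → ℕ → α)
    (k t : ℕ) : ℝ :=
  ∑ u ∈ Finset.Icc (dgcStart k t) (t - 1), (f u (w u) - f u (x k u))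

/-- `C_{t−1,I} = Σ_{u=min I}^{t−1} |f_u(w_u) − f_u(w_{u,I})|` for the active level-`k`
expert at round `t`. -/
noncomputable def aodMetaC {α : Type*} (f : ℕ → α → ℝ) (w : ℕ → α) (x : ℕ → ℕ → α)
    (k t : ℕ) : ℝ :=
  ∑ u ∈ Finset.Icc (dgcStart k t) (t - 1), |f u (w u) - f u (x k u)|

/-- The AdaNormalHedge weight `p_{t,I}` that AOD assigns to the active level-`k`
expert at round `t`. -/
noncomputable def aodWeight {α : Type*} (T : ℕ) (f : ℕ → α → ℝ) (w : ℕ → α)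
    (x : ℕ → ℕ → α) (k t : ℕ) : ℝ :=
  anhW (aodMetaR f w x k t) (aodMetaC f w x k t) /
    ∑ k' ∈ dgcLevels T, anhW (aodMetaR f w x k' t) (aodMetaC f w x k' t)

/-- `c(t) = 1 + ln t + ln(1 + log₂ T) + ln((5 + 3 ln(1+t))/2)`. -/
noncomputable def cAOD (T t : ℕ) : ℝ :=
  1 + Real.log t + Real.log (1 + Real.logb 2 T) + Real.log ((5 + 3 * Real.log (1 + (t : ℝ))) / 2)

/-- The strongly adaptive regret `SAReg(T,τ)` of the sequence `w` against losses `f`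
over domain `Ω`. -/
noncomputable def SAReg {d : ℕ} (Ω : Set (EuclideanSpace ℝ (Fin d)))
    (f : ℕ → EuclideanSpace ℝ (Fin d) → ℝ) (w : ℕ → EuclideanSpace ℝ (Fin d))
    (T τ : ℕ) : ℝ :=
  sSup { r : ℝ | ∃ s : ℕ, 1 ≤ s ∧ s + τ - 1 ≤ T ∧
    r = (∑ t ∈ Finset.Icc s (s + τ - 1), f t (w t)) -
        sInf ((fun v => ∑ t ∈ Finset.Icc s (s + τ - 1), f t v) '' Ω) }

lemma one_le_anhPot {R C : ℝ} (hC : 0 ≤ C) : 1 ≤ anhPot R C :=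
  Real.one_le_exp (by positivity)

lemma anhPot_of_nonpos {R : ℝ} (C : ℝ) (hR : R ≤ 0) : anhPot R C = 1 := by
  simp [anhPot, max_eq_right hR]

lemma anhW_nonneg {R C : ℝ} (hC : 0 ≤ C) : 0 ≤ anhW R C := by
  have h : anhPot (R - 1) (C + 1) ≤ anhPot (R + 1) (C + 1) := by
    unfold anhPot
    have : R - 1 ≤ R + 1 := by linarith
    gcongr
  unfold anhW
  linarith

lemma anhW_zero_zero_pos : 0 < anhW 0 0 := by
  have h : 1 < Real.exp (1 / 3) := Real.one_lt_exp_iff.2 (by norm_num)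
  simp only [anhW, anhPot]
  norm_num

/-- Averaging the potential over a unit step in either direction increases it by `O(1/C)`. -/
lemma anhPot_avg_le {R C : ℝ} (h : |R| ≤ C) :
    (anhPot (R + 1) (C + 1) + anhPot (R - 1) (C + 1)) / 2 ≤ anhPot R C + 3 / (C + 1) := by
  have hC : 0 ≤ C := (abs_nonneg R).trans h
  have hRC : R ≤ C := (le_abs_self R).trans h
  rcases le_total R 1 with hR | hR
  · rw [anhPot_of_nonpos (R := R - 1) _ (by linarith)]
    have h1 := one_le_anhPot (R := R) hC
    set m := max (R + 1) 0 with hm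
    have hm0 : 0 ≤ m := le_max_right _ _
    have hm2 : m ≤ 2 := max_le (by linarith) (by norm_num)
    have hmC : m ≤ C + 1 := max_le (by linarith) (by linarith)
    have hy0 : 0 ≤ m ^ 2 / (3 * (C + 1)) := by positivity
    have hy1 : m ^ 2 / (3 * (C + 1)) ≤ 1 := by
      rw [div_le_one (by positivity)]
      nlinarith
    have hy2 : m ^ 2 / (3 * (C + 1)) ≤ 3 / (C + 1) := by
      rw [div_le_div_iff₀ (by positivity) (by positivity)]
      have : m ^ 2 ≤ 9 := by nlinarith
      nlinarith
    have h2 : anhPot (R + 1) (C + 1) ≤ 1 + 2 * (m ^ 2 / (3 * (C + 1))) := by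
      have h3 := (abs_le.1 (Real.abs_exp_sub_one_sub_id_le (abs_le.2 ⟨by linarith, hy1⟩))).2
      unfold anhPot
      nlinarith
    linarith
  · have hc : 0 < C := by linarith
    have e1 : (anhPot (R + 1) (C + 1) + anhPot (R - 1) (C + 1)) / 2
        = Real.exp ((R ^ 2 + 1) / (3 * (C + 1))) * Real.cosh (2 * R / (3 * (C + 1))) := by
      rw [Real.cosh_eq, anhPot, anhPot, max_eq_left (by linarith), max_eq_left (by linarith),
        mul_div_assoc', mul_add (Real.exp _), ← Real.exp_add, ← Real.exp_add]
      congr 3 <;> (field_simp; ring)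
    set A := (R ^ 2 + 1) / (3 * (C + 1)) + (2 * R / (3 * (C + 1))) ^ 2 / 2 with hA
    set B := R ^ 2 / (3 * C) with hB
    have e2 : (anhPot (R + 1) (C + 1) + anhPot (R - 1) (C + 1)) / 2 ≤ Real.exp A := by
      rw [e1, hA, Real.exp_add]
      gcongr
      exact Real.cosh_le_exp_half_sq _
    have e3 : anhPot R C = Real.exp B := by
      rw [anhPot, max_eq_left (by linarith)]
    have hAB : A - B ≤ 1 / (3 * (C + 1)) - R ^ 2 / (9 * (C + 1) ^ 2) := by
      have : 1 / (3 * (C + 1)) - R ^ 2 / (9 * (C + 1) ^ 2) - (A - B)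
          = R ^ 2 / (3 * C * (C + 1) ^ 2) := by
        rw [hA, hB]; field_simp; ring
      have h0 : 0 ≤ R ^ 2 / (3 * C * (C + 1) ^ 2) := by positivity
      linarith
    rw [e3]
    have h3 : 0 ≤ 3 / (C + 1) := by positivity
    rcases le_total (3 * (C + 1)) (R ^ 2) with hbig | hsmall
    · have : 1 / (3 * (C + 1)) ≤ R ^ 2 / (9 * (C + 1) ^ 2) := by
        rw [div_le_div_iff₀ (by positivity) (by positivity)]
        nlinarith [mul_le_mul_of_nonneg_right hbig (by linarith : 0 ≤ 3 * (C + 1))]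
      have : Real.exp A ≤ Real.exp B := Real.exp_le_exp.2 (by linarith)
      linarith
    · have hA2 : A ≤ 2 := by
        have a1 : (R ^ 2 + 1) / (3 * (C + 1)) ≤ 7 / 6 := by
          rw [div_le_div_iff₀ (by positivity) (by positivity)]
          nlinarith
        have a2 : (2 * R / (3 * (C + 1))) ^ 2 / 2 ≤ 1 / 3 := by
          rw [div_pow, div_div, div_le_div_iff₀ (by positivity) (by positivity)]
          nlinarith
        linarith
      have hexp : Real.exp A ≤ 9 := by
        calc Real.exp A ≤ Real.exp 2 := Real.exp_le_exp.2 hA2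
          _ = Real.exp 1 ^ 2 := by rw [← Real.exp_nat_mul]; norm_num
          _ ≤ 3 ^ 2 := by
            gcongr
            exact Real.exp_one_lt_d9.le.trans (by norm_num)
          _ = 9 := by norm_num
      have hdiff : Real.exp A - Real.exp B ≤ Real.exp A * (A - B) := by
        have h4 := Real.add_one_le_exp (B - A)
        have h5 : Real.exp B = Real.exp A * Real.exp (B - A) := by
          rw [← Real.exp_add]; ring_nf
        rw [h5]
        nlinarith [Real.exp_pos A]
      have h6 : Real.exp A * (A - B) ≤ 9 * (1 / (3 * (C + 1))) := by
        have h7 : A - B ≤ 1 / (3 * (C + 1)) := by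
          have : 0 ≤ R ^ 2 / (9 * (C + 1) ^ 2) := by positivity
          linarith
        have h8 : 0 ≤ 1 / (3 * (C + 1)) := by positivity
        nlinarith [Real.exp_pos A]
      have h9 : 9 * (1 / (3 * (C + 1))) = 3 / (C + 1) := by field_simp; norm_num
      linarith

/-- The potential is convex along segments which increase `C` by one. -/
lemma anhPot_convex {R R' C l : ℝ} (h : |R| ≤ C) (hl0 : 0 ≤ l) (hl1 : l ≤ 1) :
    anhPot ((1 - l) * R + l * R') (C + l) ≤
      (1 - l) * anhPot R C + l * anhPot R' (C + 1) := by
  have hC : 0 ≤ C := (abs_nonneg R).trans h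
  have hRC : R ≤ C := (le_abs_self R).trans h
  set a := max R 0 with ha
  set b := max R' 0 with hb
  have ha0 : 0 ≤ a := le_max_right _ _
  have hb0 : 0 ≤ b := le_max_right _ _
  have haC : a ≤ C := max_le hRC hC
  have hmax : max ((1 - l) * R + l * R') 0 ≤ (1 - l) * a + l * b := by
    have h1 : 0 ≤ 1 - l := by linarith
    apply max_le
    · gcongr
      · exact le_max_left _ _
      · exact le_max_left _ _
    · positivity
  have hq : max ((1 - l) * R + l * R') 0 ^ 2 / (3 * (C + l))
      ≤ (1 - l) * (a ^ 2 / (3 * C)) + l * (b ^ 2 / (3 * (C + 1))) := by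
    calc max ((1 - l) * R + l * R') 0 ^ 2 / (3 * (C + l))
        ≤ ((1 - l) * a + l * b) ^ 2 / (3 * (C + l)) := by gcongr
      _ ≤ _ := by
        rcases hC.eq_or_lt with h0 | hpos
        · obtain rfl : C = 0 := h0.symm
          have : a = 0 := le_antisymm haC ha0
          rw [this]
          rcases hl0.eq_or_lt with rfl | hl
          · simp
          · apply le_of_eq; field_simp; ring
        · rw [← sub_nonneg]
          have : (1 - l) * (a ^ 2 / (3 * C)) + l * (b ^ 2 / (3 * (C + 1)))
              - ((1 - l) * a + l * b) ^ 2 / (3 * (C + l))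
              = l * (1 - l) * (a * (C + 1) - b * C) ^ 2 / (3 * C * (C + 1) * (C + l)) := by
            field_simp; ring
          rw [this]
          have h1 : 0 ≤ 1 - l := by linarith
          positivity
  calc anhPot ((1 - l) * R + l * R') (C + l)
      ≤ Real.exp ((1 - l) * (a ^ 2 / (3 * C)) + l * (b ^ 2 / (3 * (C + 1)))) :=
        Real.exp_le_exp.2 hq
    _ ≤ _ := by
      simpa [anhPot] using convexOn_exp.2 (Set.mem_univ (a ^ 2 / (3 * C)))
        (Set.mem_univ (b ^ 2 / (3 * (C + 1)))) (by linarith : 0 ≤ 1 - l) hl0 (by ring)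

/-- One-step growth of the AdaNormalHedge potential. -/
lemma anhPot_step {R C r : ℝ} (h : |R| ≤ C) (hr : |r| ≤ 1) :
    anhPot (R + r) (C + |r|) ≤ anhPot R C + anhW R C * r + 3 * (|r| / (C + 1)) := by
  have hC : 0 ≤ C := (abs_nonneg R).trans h
  have havg := mul_le_mul_of_nonneg_left (anhPot_avg_le h) (abs_nonneg r)
  rcases le_total 0 r with h0 | h0
  · have hconv := anhPot_convex (R' := R + 1) h (abs_nonneg r) hr
    rw [abs_of_nonneg h0] at *
    rw [show (1 - r) * R + r * (R + 1) = R + r by ring] at hconv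
    have : r * (3 / (C + 1)) = 3 * (r / (C + 1)) := by ring
    unfold anhW
    linarith
  · have hconv := anhPot_convex (R' := R - 1) h (abs_nonneg r) hr
    rw [abs_of_nonpos h0] at *
    rw [show (1 - -r) * R + -r * (R - 1) = R + r by ring] at hconv
    have : -r * (3 / (C + 1)) = 3 * (-r / (C + 1)) := by ring
    unfold anhW
    linarith

/-- A telescoping majorant of `r / (C + 1)`. -/
lemma div_succ_le_log_telescope {C r : ℝ} (hC : 0 ≤ C) (hr0 : 0 ≤ r) (hr1 : r ≤ 1) :
    r / (C + 1) ≤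
      (Real.log (1 + (C + r)) - 1 / (1 + (C + r))) - (Real.log (1 + C) - 1 / (1 + C)) := by
  have h1 : Real.log (1 + C) - Real.log (1 + (C + r)) ≤ (1 + C) / (1 + (C + r)) - 1 := by
    rw [← Real.log_div (by positivity) (by positivity)]
    exact Real.log_le_sub_one_of_pos (by positivity)
  have h2 : r / (C + 1) ≤ (1 - (1 + C) / (1 + (C + r))) + (1 / (1 + C) - 1 / (1 + (C + r))) := by
    rw [← sub_nonneg]
    have : (1 - (1 + C) / (1 + (C + r))) + (1 / (1 + C) - 1 / (1 + (C + r))) - r / (C + 1)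
        = r * (1 - r) / ((1 + C) * (1 + (C + r))) := by
      field_simp; ring
    rw [this]
    have h3 : 0 ≤ 1 - r := by linarith
    positivity
  linarith

lemma sqrt_add_four_sqrt_le {x y : ℝ} (hx : 0 ≤ x) (hy : 0 ≤ y) (h : y ≤ x) :
    √x + 4 * √y ≤ 4 * √(x + y) := by
  have h1 : √y ≤ √x := Real.sqrt_le_sqrt h
  have h2 : (√x + 4 * √y) ≤ √(16 * (x + y)) := by
    apply Real.le_sqrt_of_sq_le
    nlinarith [Real.sq_sqrt hx, Real.sq_sqrt hy, Real.sqrt_nonneg x, Real.sqrt_nonneg y,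
      mul_le_mul_of_nonneg_left h1 (Real.sqrt_nonneg x)]
  rwa [Real.sqrt_mul (by norm_num), show √(16 : ℝ) = 4 by
    rw [show (16 : ℝ) = 4 ^ 2 by norm_num]; exact Real.sqrt_sq (by norm_num)] at h2

/-- A gap function bounded by `B √(2^k)` on dyadic blocks is bounded by `4 B √n` on
intervals of length `n` which begin at a dyadic point. -/
lemma dyadic_right {S : ℕ → ℝ} {T : ℕ} {B : ℝ} (hB : 0 ≤ B)
    (hS : ∀ k i, (i + 1) * 2 ^ k ≤ T →
      S ((i + 1) * 2 ^ k) - S (i * 2 ^ k) ≤ B * √((2 : ℝ) ^ k)) :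
    ∀ k m n, n ≤ 2 ^ k → m * 2 ^ k + n ≤ T →
      S (m * 2 ^ k + n) - S (m * 2 ^ k) ≤ 4 * B * √(n : ℝ) := by
  intro k
  induction k with
  | zero =>
    intro m n hn hT
    obtain rfl | rfl : n = 0 ∨ n = 1 := by
      rw [pow_zero] at hn; omega
    · simp
    · have := hS 0 m (by simpa using hT)
      simp at this ⊢
      linarith
  | succ k ih =>
    intro m n hn hT
    have e : m * 2 ^ (k + 1) = (2 * m) * 2 ^ k := by ring
    rw [e] at hT ⊢
    rcases le_total n (2 ^ k) with h | h
    · exact ih _ _ h hT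
    · obtain ⟨q, rfl⟩ := Nat.exists_eq_add_of_le h
      have e2 : 2 * m * 2 ^ k + (2 ^ k + q) = (2 * m + 1) * 2 ^ k + q := by ring
      rw [e2] at hT ⊢
      have hq : q ≤ 2 ^ k := by rw [pow_succ] at hn; omega
      have h1 := ih (2 * m + 1) q hq hT
      have h2 := hS k (2 * m) (by omega)
      have h3 := sqrt_add_four_sqrt_le (x := (2 : ℝ) ^ k) (y := q) (by positivity) (by positivity)
        (by exact_mod_cast hq)
      have h4 := mul_le_mul_of_nonneg_left h3 hB
      push_cast
      linarith

/-- The mirror image of `dyadic_right`, for intervals which end at a dyadic point. -/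
lemma dyadic_left {S : ℕ → ℝ} {T : ℕ} {B : ℝ} (hB : 0 ≤ B)
    (hS : ∀ k i, (i + 1) * 2 ^ k ≤ T →
      S ((i + 1) * 2 ^ k) - S (i * 2 ^ k) ≤ B * √((2 : ℝ) ^ k)) :
    ∀ k m a n : ℕ, n ≤ 2 ^ k → a + n = m * 2 ^ k → m * 2 ^ k ≤ T →
      S (m * 2 ^ k) - S a ≤ 4 * B * √(n : ℝ) := by
  intro k
  induction k with
  | zero =>
    intro m a n hn ha hT
    obtain rfl | rfl : n = 0 ∨ n = 1 := by
      rw [pow_zero] at hn; omega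
    · rw [← ha]; simp
    · rw [← ha] at hT ⊢
      have := hS 0 a (by simpa using hT)
      simp at this ⊢
      linarith
  | succ k ih =>
    intro m a n hn ha hT
    have e : m * 2 ^ (k + 1) = (2 * m) * 2 ^ k := by ring
    rw [e] at hT ha ⊢
    rcases le_total n (2 ^ k) with h | h
    · exact ih _ _ _ h ha hT
    · obtain ⟨q, rfl⟩ := Nat.exists_eq_add_of_le h
      obtain ⟨j, hj⟩ : ∃ j, 2 * m = j + 1 := by
        refine ⟨2 * m - 1, ?_⟩
        have : 0 < 2 ^ k := by positivity
        have : 2 * m ≠ 0 := by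
          intro h0
          rw [h0] at ha
          omega
        omega
      rw [hj] at hT ha ⊢
      have hq : q ≤ 2 ^ k := by rw [pow_succ] at hn; omega
      have e2 : (j + 1) * 2 ^ k = j * 2 ^ k + 2 ^ k := by ring
      have h1 := ih j a q hq (by omega) (by omega)
      have h2 := hS k j hT
      have h3 := sqrt_add_four_sqrt_le (x := (2 : ℝ) ^ k) (y := q) (by positivity) (by positivity)
        (by exact_mod_cast hq)
      have h4 := mul_le_mul_of_nonneg_left h3 hB
      push_cast
      linarith

/-- Every interval splits at a dyadic point of scale at least the length of both parts. -/
lemma exists_dyadic_split : ∀ K m a b : ℕ, m * 2 ^ K ≤ a → a ≤ b → b ≤ (m + 1) * 2 ^ K →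
    ∃ k p, a ≤ p * 2 ^ k ∧ p * 2 ^ k ≤ b ∧ p * 2 ^ k ≤ a + 2 ^ k ∧ b ≤ p * 2 ^ k + 2 ^ k := by
  intro K
  induction K with
  | zero =>
    intro m a b h1 h2 h3
    refine ⟨0, a, ?_⟩
    simp at *
    omega
  | succ K ih =>
    intro m a b h1 h2 h3
    have e1 : m * 2 ^ (K + 1) = 2 * m * 2 ^ K := by ring
    have e2 : (m + 1) * 2 ^ (K + 1) = (2 * m + 1 + 1) * 2 ^ K := by ring
    have e3 : (2 * m + 1) * 2 ^ K = 2 * m * 2 ^ K + 2 ^ K := by ring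
    have e4 : (2 * m + 1 + 1) * 2 ^ K = 2 * m * 2 ^ K + 2 ^ K + 2 ^ K := by ring
    rcases le_total b ((2 * m + 1) * 2 ^ K) with h | h
    · exact ih (2 * m) a b (by omega) h2 h
    · rcases le_total ((2 * m + 1) * 2 ^ K) a with h' | h'
      · exact ih (2 * m + 1) a b h' h2 (by omega)
      · exact ⟨K, 2 * m + 1, by omega, by omega, by omega, by omega⟩

/-- A gap function bounded by `B √(2^k)` on the dyadic blocks within `[0, T]` is bounded by
`8 B √(b - a)` on every interval. -/
lemma sub_le_of_dyadic {S : ℕ → ℝ} {T : ℕ} {B : ℝ} (hB : 0 ≤ B)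
    (hS : ∀ k i, (i + 1) * 2 ^ k ≤ T →
      S ((i + 1) * 2 ^ k) - S (i * 2 ^ k) ≤ B * √((2 : ℝ) ^ k))
    (a n : ℕ) (hT : a + n ≤ T) : S (a + n) - S a ≤ 8 * B * √(n : ℝ) := by
  obtain ⟨k, p, h1, h2, h3, h4⟩ := exists_dyadic_split (a + n) 0 a (a + n) (by simp) (by omega)
    (by rw [zero_add, one_mul]; exact Nat.lt_two_pow_self.le)
  obtain ⟨l, hl⟩ := Nat.exists_eq_add_of_le h1
  obtain ⟨q, hq⟩ := Nat.exists_eq_add_of_le h2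
  have hr := dyadic_right hB hS k p q (by omega) (by omega)
  have hl' := dyadic_left hB hS k p a l (by omega) (by omega) (by omega)
  rw [← hq] at hr
  have s1 : √(l : ℝ) ≤ √(n : ℝ) := Real.sqrt_le_sqrt (by exact_mod_cast (by omega : l ≤ n))
  have s2 : √(q : ℝ) ≤ √(n : ℝ) := Real.sqrt_le_sqrt (by exact_mod_cast (by omega : q ≤ n))
  nlinarith [mul_le_mul_of_nonneg_left s1 hB, mul_le_mul_of_nonneg_left s2 hB]

/-- First-order lower bound for a differentiable convex function. -/
lemma ConvexOn.sub_le_inner_gradient {E : Type*} [NormedAddCommGroup E] [InnerProductSpace ℝ E]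
    [CompleteSpace E] {f : E → ℝ} (hf : ConvexOn ℝ Set.univ f) {z : E}
    (hd : DifferentiableAt ℝ f z) (v : E) : f z - f v ≤ inner ℝ (gradient f z) (z - v) := by
  have hline : ConvexOn ℝ Set.univ (f ∘ AffineMap.lineMap (k := ℝ) z v) := by
    simpa using hf.comp_affineMap (AffineMap.lineMap (k := ℝ) z v)
  have hder : HasDerivAt (f ∘ AffineMap.lineMap (k := ℝ) z v) (fderiv ℝ f z (v - z)) 0 := by
    refine HasFDerivAt.comp_hasDerivAt (0 : ℝ) ?_ AffineMap.hasDerivAt_lineMap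
    simpa using hd.hasFDerivAt
  have h := hline.le_slope_of_hasDerivAt (Set.mem_univ 0) (Set.mem_univ 1) one_pos hder
  simp only [slope_def_field, Function.comp_apply, AffineMap.lineMap_apply_zero,
    AffineMap.lineMap_apply_one, sub_zero, div_one] at h
  rw [inner_gradient_left, ← neg_sub v z, map_neg]
  linarith

/-- A nearest-point map onto a convex set does not increase the distance to points of the set. -/
lemma norm_proj_sub_le {E : Type*} [NormedAddCommGroup E] [InnerProductSpace ℝ E]
    {Ω : Set E} (hconv : Convex ℝ Ω) {z y v : E} (hy : y ∈ Ω)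
    (hmin : ∀ z' ∈ Ω, ‖y - z‖ ≤ ‖z' - z‖) (hv : v ∈ Ω) : ‖y - v‖ ^ 2 ≤ ‖z - v‖ ^ 2 := by
  have hinf : ‖z - y‖ = ⨅ w : Ω, ‖z - w‖ := by
    have : Nonempty Ω := ⟨⟨y, hy⟩⟩
    apply le_antisymm
    · refine le_ciInf fun w => ?_
      simpa [norm_sub_rev] using hmin w w.2
    · exact ciInf_le (f := fun w : Ω => ‖z - w‖)
        ⟨0, by rintro _ ⟨w, rfl⟩; exact norm_nonneg _⟩ ⟨y, hy⟩
  have h := (norm_eq_iInf_iff_real_inner_le_zero hconv hy).1 hinf v hv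
  have e : ‖z - v‖ ^ 2 = ‖z - y‖ ^ 2 + 2 * inner ℝ (z - y) (y - v) + ‖y - v‖ ^ 2 := by
    rw [← norm_add_sq_real, sub_add_sub_cancel]
  have e2 : inner ℝ (z - y) (y - v) = -inner ℝ (z - y) (v - y) := by
    rw [← inner_neg_right, neg_sub]
  nlinarith [sq_nonneg ‖z - y‖]

/-- Regret of projected online gradient descent over a window of `n` rounds, from an arbitrary
starting point of the domain. -/
lemma ogd_regret_le {E : Type*} [NormedAddCommGroup E] [InnerProductSpace ℝ E] [CompleteSpace E]
    {Ω : Set E} (hconv : Convex ℝ Ω) {D G η : ℝ}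
    (hdiam : ∀ z ∈ Ω, ∀ z' ∈ Ω, ‖z - z'‖ ≤ D)
    {f : ℕ → E → ℝ} (hfconv : ∀ t, ConvexOn ℝ Set.univ (f t))
    (hfdiff : ∀ t z, DifferentiableAt ℝ (f t) z)
    (hgrad : ∀ t, ∀ z ∈ Ω, ‖gradient (f t) z‖ ≤ G)
    {proj : E → E} (hproj : ∀ z, proj z ∈ Ω ∧ ∀ z' ∈ Ω, ‖proj z - z‖ ≤ ‖z' - z‖)
    {x : ℕ → E} (hx : ∀ t, 1 ≤ t → x t ∈ Ω)
    (hxup : ∀ t, 1 ≤ t → x (t + 1) = proj (x t - η • gradient (f t) (x t)))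
    {n : ℕ} (hη : η = D / (G * √(n : ℝ))) (hn : 1 ≤ n) {v : E} (hv : v ∈ Ω) (a : ℕ) :
    ∑ t ∈ Finset.Icc (a + 1) (a + n), (f t (x t) - f t v) ≤ D * G * √(n : ℝ) := by
  have hlin : ∀ t, f t (x t) - f t v ≤ inner ℝ (gradient (f t) (x t)) (x t - v) :=
    fun t => (hfconv t).sub_le_inner_gradient (hfdiff t _) v
  have hD0 : 0 ≤ D := (norm_nonneg _).trans (hdiam v hv v hv)
  have hG0 : 0 ≤ G := (norm_nonneg _).trans (hgrad 0 v hv)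
  have hn0 : (0 : ℝ) < n := by exact_mod_cast hn
  rcases (mul_nonneg hD0 hG0).eq_or_lt with hDG | hDG
  · rw [← hDG, zero_mul]
    refine Finset.sum_nonpos fun t ht => (hlin t).trans ?_
    have ht1 : 1 ≤ t := by have := (Finset.mem_Icc.1 ht).1; omega
    calc inner ℝ (gradient (f t) (x t)) (x t - v)
        ≤ ‖gradient (f t) (x t)‖ * ‖x t - v‖ := real_inner_le_norm _ _
      _ ≤ G * D := by
        gcongr
        · exact hgrad t _ (hx t ht1)
        · exact hdiam _ (hx t ht1) v hv
      _ = 0 := by rw [mul_comm, ← hDG]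
  · have hDpos : 0 < D := hD0.lt_of_ne (by rintro rfl; simp at hDG)
    have hGpos : 0 < G := hG0.lt_of_ne (by rintro rfl; simp at hDG)
    have hs : 0 < √(n : ℝ) := Real.sqrt_pos.2 hn0
    have hηpos : 0 < η := by rw [hη]; positivity
    have hstep : ∀ t, 1 ≤ t → 2 * η * (f t (x t) - f t v) ≤
        ‖x t - v‖ ^ 2 - ‖x (t + 1) - v‖ ^ 2 + η ^ 2 * G ^ 2 := by
      intro t ht
      have h1 := norm_proj_sub_le hconv (hproj (x t - η • gradient (f t) (x t))).1
        (hproj (x t - η • gradient (f t) (x t))).2 hv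
      rw [← hxup t ht, sub_right_comm, norm_sub_sq_real (x t - v), inner_smul_right, norm_smul, mul_pow,
        Real.norm_eq_abs, sq_abs, real_inner_comm] at h1
      have h2 : ‖gradient (f t) (x t)‖ ^ 2 ≤ G ^ 2 := by
        gcongr
        exact hgrad t _ (hx t ht)
      have h3 := mul_le_mul_of_nonneg_left (hlin t) hηpos.le
      have h4 := mul_le_mul_of_nonneg_left h2 (sq_nonneg η)
      linarith
    have hsum : ∀ m, 2 * η * ∑ t ∈ Finset.Icc (a + 1) (a + m), (f t (x t) - f t v) ≤
        ‖x (a + 1) - v‖ ^ 2 - ‖x (a + m + 1) - v‖ ^ 2 + m * (η ^ 2 * G ^ 2) := by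
      intro m
      induction m with
      | zero => simp
      | succ m ih =>
        rw [← add_assoc, Finset.sum_Icc_succ_top (by omega), mul_add]
        have := hstep (a + m + 1) (by omega)
        push_cast
        linarith
    have h1 := hsum n
    have h2 : ‖x (a + 1) - v‖ ^ 2 ≤ D ^ 2 := by
      gcongr
      exact hdiam _ (hx _ (by omega)) v hv
    have h3 : 2 * η * (D * G * √(n : ℝ)) = D ^ 2 + n * (η ^ 2 * G ^ 2) := by
      rw [hη]
      have := Real.sq_sqrt hn0.le
      field_simp
      rw [this]
      ring
    have h4 : 2 * η * ∑ t ∈ Finset.Icc (a + 1) (a + n), (f t (x t) - f t v) ≤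
        2 * η * (D * G * √(n : ℝ)) := by
      nlinarith [sq_nonneg ‖x (a + n + 1) - v‖]
    exact le_of_mul_le_mul_left h4 (by positivity)

lemma dgcStart_le (k : ℕ) {t : ℕ} (ht : 1 ≤ t) : dgcStart k t ≤ t := by
  have := Nat.div_mul_le_self (t - 1) (2 ^ k)
  unfold dgcStart
  omega

lemma one_le_dgcStart (k t : ℕ) : 1 ≤ dgcStart k t := Nat.le_add_left _ _

lemma dgcStart_one (k : ℕ) : dgcStart k 1 = 1 := by simp [dgcStart]

lemma dgcStart_succ (k : ℕ) {t : ℕ} (ht : 1 ≤ t) :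
    dgcStart k (t + 1) = dgcStart k t ∨ dgcStart k (t + 1) = t + 1 := by
  obtain ⟨a, rfl⟩ := Nat.exists_eq_add_of_le' ht
  simp only [dgcStart, Nat.add_sub_cancel, Nat.succ_div]
  split_ifs with h
  · right
    have := Nat.div_mul_cancel h
    rw [Nat.succ_div_of_dvd h] at this
    rw [this]
  · left; simp

lemma dgcStart_end (k i : ℕ) : dgcStart k ((i + 1) * 2 ^ k) = i * 2 ^ k + 1 := by
  have h : 0 < 2 ^ k := by positivity
  have : ((i + 1) * 2 ^ k - 1) / 2 ^ k = i := by
    rw [add_mul, one_mul, Nat.add_sub_assoc h, mul_comm, Nat.mul_add_div h,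
      Nat.div_eq_of_lt (by omega), add_zero]
  rw [dgcStart, this]

lemma zero_mem_dgcLevels {T : ℕ} (hT : 1 ≤ T) : 0 ∈ dgcLevels T := by
  simp [dgcLevels, hT]

lemma mem_dgcLevels {T k : ℕ} (h : 2 ^ k ≤ T) : k ∈ dgcLevels T := by
  have : k < 2 ^ k := Nat.lt_two_pow_self
  simp only [dgcLevels, Finset.mem_filter, Finset.mem_range]
  omega

lemma card_dgcLevels_le (T : ℕ) :
    ((dgcLevels T).card : ℝ) ≤ 1 + Real.logb 2 T := by
  have hsub : dgcLevels T ⊆ Finset.range (Nat.log 2 T + 1) := by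
    intro k hk
    rw [Finset.mem_range, Nat.lt_succ_iff]
    exact Nat.le_log_of_pow_le one_lt_two (Finset.mem_filter.1 hk).2
  have h1 := Finset.card_le_card hsub
  rw [Finset.card_range] at h1
  have h2 : (Nat.log 2 T : ℝ) ≤ Real.logb 2 T := by exact_mod_cast Real.natLog_le_logb T 2
  have h3 : ((dgcLevels T).card : ℝ) ≤ Nat.log 2 T + 1 := by exact_mod_cast h1
  linarith

section Meta

variable {α : Type*} (f : ℕ → α → ℝ) (w : ℕ → α) (x : ℕ → ℕ → α)

lemma abs_aodMetaR_le (k t : ℕ) : |aodMetaR f w x k t| ≤ aodMetaC f w x k t :=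
  Finset.abs_sum_le_sum_abs _ _

lemma aodMetaC_nonneg (k t : ℕ) : 0 ≤ aodMetaC f w x k t :=
  (abs_nonneg _).trans (abs_aodMetaR_le f w x k t)

lemma sum_Icc_dgcStart (g : ℕ → ℝ) (k : ℕ) {t : ℕ} (ht : 1 ≤ t) :
    ∑ u ∈ Finset.Icc (dgcStart k t) t, g u =
      ∑ u ∈ Finset.Icc (dgcStart k t) (t - 1), g u + g t := by
  have h := dgcStart_le k ht
  obtain ⟨a, rfl⟩ := Nat.exists_eq_add_of_le' ht
  rw [Nat.add_sub_cancel, Finset.sum_Icc_succ_top h]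

lemma aodMetaC_add_le (hr : ∀ k t, 1 ≤ t → |f t (w t) - f t (x k t)| ≤ 1) (k : ℕ) {t : ℕ}
    (ht : 1 ≤ t) :
    aodMetaC f w x k t + |f t (w t) - f t (x k t)| ≤ (t + 1 - dgcStart k t : ℕ) := by
  rw [aodMetaC, ← sum_Icc_dgcStart (fun u => |f u (w u) - f u (x k u)|) k ht]
  calc _ ≤ ∑ u ∈ Finset.Icc (dgcStart k t) t, (1 : ℝ) := by
        refine Finset.sum_le_sum fun u hu => hr k u ?_
        exact (one_le_dgcStart k t).trans (Finset.mem_Icc.1 hu).1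
    _ = _ := by simp

/-- At each round the statistics of a level are either updated or reset. -/
lemma aodMeta_succ (k : ℕ) {t : ℕ} (ht : 1 ≤ t) :
    (aodMetaR f w x k (t + 1) = aodMetaR f w x k t + (f t (w t) - f t (x k t)) ∧
      aodMetaC f w x k (t + 1) = aodMetaC f w x k t + |f t (w t) - f t (x k t)|) ∨
    (aodMetaR f w x k (t + 1) = 0 ∧ aodMetaC f w x k (t + 1) = 0) := by
  rcases dgcStart_succ k ht with h | h
  · left
    simp only [aodMetaR, aodMetaC, h, Nat.add_sub_cancel]
    exact ⟨sum_Icc_dgcStart (fun u => f u (w u) - f u (x k u)) k ht,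
      sum_Icc_dgcStart (fun u => |f u (w u) - f u (x k u)|) k ht⟩
  · right
    simp [aodMetaR, aodMetaC, h]

/-- The potential of each level, after every round, is bounded by the total initial potential of
the intervals started so far, up to a logarithmic factor. -/
lemma anhPot_aodMeta_le {T : ℕ} (hr : ∀ k t, 1 ≤ t → |f t (w t) - f t (x k t)| ≤ 1)
    (hW : ∀ t, 1 ≤ t → ∑ k ∈ dgcLevels T, anhW (aodMetaR f w x k t) (aodMetaC f w x k t) *
      (f t (w t) - f t (x k t)) ≤ 0)
    {k t : ℕ} (hk : k ∈ dgcLevels T) (ht : 1 ≤ t) (htT : t ≤ T) :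
    anhPot (aodMetaR f w x k t + (f t (w t) - f t (x k t)))
        (aodMetaC f w x k t + |f t (w t) - f t (x k t)|) ≤
      (dgcLevels T).card * (T * (4 + 3 * Real.log (1 + (T : ℝ)))) := by
  set r : ℕ → ℕ → ℝ := fun k t => f t (w t) - f t (x k t) with hrdef
  set R := aodMetaR f w x with hR
  set C := aodMetaC f w x with hC
  set L := Real.log (1 + (T : ℝ)) with hL
  have hL0 : 0 ≤ L := Real.log_nonneg (by have : (0 : ℝ) ≤ T := T.cast_nonneg; linarith)
  have hC0 : ∀ k t, 0 ≤ C k t := aodMetaC_nonneg f w x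
  set F : ℝ → ℝ → ℝ := fun R C => anhPot R C - 3 * (Real.log (1 + C) - 1 / (1 + C)) with hF
  have hF0 : F 0 0 = 4 := by simp [hF, anhPot]; norm_num
  have hcor : ∀ k t, 1 ≤ t → t ≤ T →
      Real.log (1 + (C k t + |r k t|)) - 1 / (1 + (C k t + |r k t|)) ≤ L := by
    intro k t ht htT
    have h0 : 0 ≤ C k t + |r k t| := add_nonneg (hC0 k t) (abs_nonneg _)
    have h1 : C k t + |r k t| ≤ T := by
      refine (aodMetaC_add_le f w x hr k ht).trans ?_
      have := one_le_dgcStart k t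
      exact_mod_cast (by omega : t + 1 - dgcStart k t ≤ T)
    have h2 : 0 ≤ 1 / (1 + (C k t + |r k t|)) := by positivity
    have h3 : Real.log (1 + (C k t + |r k t|)) ≤ L :=
      Real.log_le_log (by linarith) (by linarith)
    linarith
  have hstep : ∀ t, 1 ≤ t → ∑ k ∈ dgcLevels T, F (R k t + r k t) (C k t + |r k t|) ≤
      ∑ k ∈ dgcLevels T, F (R k t) (C k t) := by
    intro t ht
    have h1 : ∀ k ∈ dgcLevels T, F (R k t + r k t) (C k t + |r k t|) ≤
        F (R k t) (C k t) + anhW (R k t) (C k t) * r k t := by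
      intro k _
      have h2 := anhPot_step (abs_aodMetaR_le f w x k t) (hr k t ht)
      have h3 := div_succ_le_log_telescope (hC0 k t) (abs_nonneg (r k t)) (hr k t ht)
      simp only [hF]
      linarith
    refine (Finset.sum_le_sum h1).trans ?_
    rw [Finset.sum_add_distrib]
    have := hW t ht
    linarith
  have hnext : ∀ k t, 1 ≤ t → t ≤ T → F (R k (t + 1)) (C k (t + 1)) ≤
      F (R k t + r k t) (C k t + |r k t|) + (3 + 3 * L) := by
    intro k t ht htT
    rcases aodMeta_succ f w x k ht with ⟨h1, h2⟩ | ⟨h1, h2⟩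
    · rw [hR, hC, h1, h2]
      linarith
    · rw [hR, hC, h1, h2, hF0]
      have h3 := hcor k t ht htT
      have h4 := one_le_anhPot (R := R k t + r k t) (add_nonneg (hC0 k t) (abs_nonneg (r k t)))
      simp only [hF]
      linarith
  have hmain : ∀ n, n + 1 ≤ T → ∑ k ∈ dgcLevels T, F (R k (n + 1)) (C k (n + 1)) ≤
      (dgcLevels T).card * (4 + n * (3 + 3 * L)) := by
    intro n
    induction n with
    | zero =>
      intro _
      have h1 : ∀ k, R k 1 = 0 ∧ C k 1 = 0 := by
        simp [hR, hC, aodMetaR, aodMetaC, dgcStart_one]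
      simp [h1, hF0]
    | succ n ih =>
      intro hn
      have h1 := ih (by omega)
      have h2 := hstep (n + 1) (by omega)
      have h3 := Finset.sum_le_sum fun k (_ : k ∈ dgcLevels T) =>
        hnext k (n + 1) (by omega) (by omega)
      rw [Finset.sum_add_distrib, Finset.sum_const, nsmul_eq_mul] at h3
      push_cast
      linarith
  obtain ⟨n, rfl⟩ := Nat.exists_eq_add_of_le' ht
  have h1 := (hstep (n + 1) ht).trans (hmain n htT)
  have h2 : ∑ k ∈ dgcLevels T, anhPot (R k (n + 1) + r k (n + 1)) (C k (n + 1) + |r k (n + 1)|) ≤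
      (dgcLevels T).card * (4 + n * (3 + 3 * L)) + (dgcLevels T).card * (3 * L) := by
    have h3 : ∀ k ∈ dgcLevels T,
        anhPot (R k (n + 1) + r k (n + 1)) (C k (n + 1) + |r k (n + 1)|) ≤
        F (R k (n + 1) + r k (n + 1)) (C k (n + 1) + |r k (n + 1)|) + 3 * L := by
      intro k _
      have := hcor k (n + 1) ht htT
      simp only [hF]
      linarith
    have h4 := Finset.sum_le_sum h3
    rw [Finset.sum_add_distrib, Finset.sum_const, nsmul_eq_mul] at h4
    linarith
  have h3 := Finset.single_le_sum (f := fun k =>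
    anhPot (R k (n + 1) + r k (n + 1)) (C k (n + 1) + |r k (n + 1)|))
    (fun k _ => zero_le_one.trans (one_le_anhPot (add_nonneg (hC0 k _) (abs_nonneg _)))) hk
  refine (h3.trans h2).trans ?_
  rw [← mul_add]
  gcongr
  have h5 : (n : ℝ) + 1 ≤ T := by exact_mod_cast htT
  nlinarith [mul_le_mul_of_nonneg_right h5 (by linarith : 0 ≤ 4 + 3 * L), n.cast_nonneg (α := ℝ)]

/-- Regret of the meta-algorithm against the expert of a dyadic block. -/
lemma aod_meta_regret_le {T : ℕ} (hr : ∀ k t, 1 ≤ t → |f t (w t) - f t (x k t)| ≤ 1)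
    (hW : ∀ t, 1 ≤ t → ∑ k ∈ dgcLevels T, anhW (aodMetaR f w x k t) (aodMetaC f w x k t) *
      (f t (w t) - f t (x k t)) ≤ 0)
    {k i : ℕ} (hT : (i + 1) * 2 ^ k ≤ T) :
    ∑ t ∈ Finset.Icc (i * 2 ^ k + 1) ((i + 1) * 2 ^ k), (f t (w t) - f t (x k t)) ≤
      √(3 * cAOD T T) * √((2 : ℝ) ^ k) := by
  have hpow : 0 < 2 ^ k := by positivity
  have hmul : (i + 1) * 2 ^ k = i * 2 ^ k + 2 ^ k := by ring
  set t := (i + 1) * 2 ^ k with ht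
  have ht1 : 1 ≤ t := by omega
  have hstart : dgcStart k t = i * 2 ^ k + 1 := dgcStart_end k i
  have hpot := anhPot_aodMeta_le f w x hr hW (mem_dgcLevels (by omega : 2 ^ k ≤ T)) ht1 hT
  have hCle := aodMetaC_add_le f w x hr k ht1
  have hRsum := sum_Icc_dgcStart (fun u => f u (w u) - f u (x k u)) k ht1
  have habs : |aodMetaR f w x k t + (f t (w t) - f t (x k t))| ≤
      aodMetaC f w x k t + |f t (w t) - f t (x k t)| :=
    (abs_add_le _ _).trans (by gcongr; exact abs_aodMetaR_le f w x k t)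
  rw [hstart] at hRsum hCle
  rw [hRsum]
  have hRdef : ∑ u ∈ Finset.Icc (i * 2 ^ k + 1) (t - 1), (f u (w u) - f u (x k u)) =
      aodMetaR f w x k t := by rw [aodMetaR, hstart]
  rw [hRdef]
  set R := aodMetaR f w x k t + (f t (w t) - f t (x k t))
  set C := aodMetaC f w x k t + |f t (w t) - f t (x k t)|
  have hCk : C ≤ (2 : ℝ) ^ k := by
    refine hCle.trans ?_
    exact_mod_cast (by omega : t + 1 - (i * 2 ^ k + 1) ≤ 2 ^ k)
  have hT1 : 1 ≤ T := by omega
  have hTpos : (0 : ℝ) < T := by exact_mod_cast hT1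
  have hL0 : 0 ≤ Real.log (1 + (T : ℝ)) := Real.log_nonneg (by linarith)
  have hN0 : 0 ≤ Real.logb 2 T :=
    Real.logb_nonneg one_lt_two (by exact_mod_cast hT1)
  have hexp : Real.exp (cAOD T T) = Real.exp 1 * T * (1 + Real.logb 2 T) *
      ((5 + 3 * Real.log (1 + (T : ℝ))) / 2) := by
    rw [cAOD, Real.exp_add, Real.exp_add, Real.exp_add, Real.exp_log hTpos,
      Real.exp_log (by positivity), Real.exp_log (by positivity)]
  have hle : Real.exp (max R 0 ^ 2 / (3 * C)) ≤ Real.exp (cAOD T T) := by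
    refine hpot.trans ?_
    have he : (2 : ℝ) ≤ Real.exp 1 := by
      have := Real.add_one_le_exp (1 : ℝ)
      linarith
    calc ((dgcLevels T).card : ℝ) * (T * (4 + 3 * Real.log (1 + (T : ℝ))))
        ≤ (1 + Real.logb 2 T) *
            (T * (Real.exp 1 * ((5 + 3 * Real.log (1 + (T : ℝ))) / 2))) := by
          gcongr
          · exact card_dgcLevels_le T
          · nlinarith
      _ = Real.exp (cAOD T T) := by rw [hexp]; ring
  have hq : max R 0 ^ 2 / (3 * C) ≤ cAOD T T := Real.exp_le_exp.1 hle
  have hC0 : 0 ≤ C := (abs_nonneg R).trans habs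
  have hc0 : 0 ≤ cAOD T T := le_trans (by positivity) hq
  rw [← Real.sqrt_mul (by positivity)]
  rcases hC0.eq_or_lt with h0 | hpos
  · have : R ≤ 0 := (le_abs_self R).trans (habs.trans h0.ge)
    exact this.trans (Real.sqrt_nonneg _)
  · refine (le_max_left R 0).trans (Real.le_sqrt_of_sq_le ?_)
    rw [div_le_iff₀ (by positivity)] at hq
    nlinarith [mul_le_mul_of_nonneg_left hCk hc0]

end Meta

/-- Theorem 4, strongly adaptive regret of AOD: under the AOD
algorithm with horizon `T`, for every `1 ≤ τ ≤ T`,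
`SAReg(T,τ) ≤ 8(√(3c(T)) + DG)·√τ`. -/
theorem aod_strongly_adaptive_regret
    (d T : ℕ) (hT : 1 ≤ T) (D G : ℝ)
    (Ω : Set (EuclideanSpace ℝ (Fin d)))
    (hne : Ω.Nonempty) (hcomp : IsCompact Ω) (hconv : Convex ℝ Ω)
    (hdiam : ∀ z ∈ Ω, ∀ z' ∈ Ω, ‖z - z'‖ ≤ D)
    (f : ℕ → EuclideanSpace ℝ (Fin d) → ℝ)
    (hfconv : ∀ t, ConvexOn ℝ Set.univ (f t))
    (hfdiff : ∀ t z, DifferentiableAt ℝ (f t) z)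
    (hgrad : ∀ t, ∀ z ∈ Ω, ‖gradient (f t) z‖ ≤ G)
    (hrange : ∀ t, ∀ z ∈ Ω, 0 ≤ f t z ∧ f t z ≤ 1)
    (proj : EuclideanSpace ℝ (Fin d) → EuclideanSpace ℝ (Fin d))
    (hproj : ∀ z, proj z ∈ Ω ∧ ∀ z' ∈ Ω, ‖proj z - z‖ ≤ ‖z' - z‖)
    (x : ℕ → ℕ → EuclideanSpace ℝ (Fin d))
    (hx1 : ∀ k, x k 1 ∈ Ω)
    (hxup : ∀ k t, 1 ≤ t →
      x k (t + 1) = proj (x k t - (D / (G * Real.sqrt ((2 : ℝ) ^ k))) • gradient (f t) (x k t)))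
    (w : ℕ → EuclideanSpace ℝ (Fin d))
    (hw : ∀ t, 1 ≤ t → w t = ∑ k ∈ dgcLevels T, aodWeight T f w x k t • x k t)
    (τ : ℕ) (hτ1 : 1 ≤ τ) (hτT : τ ≤ T) :
    SAReg Ω f w T τ ≤ 8 * (Real.sqrt (3 * cAOD T T) + D * G) * Real.sqrt (τ : ℝ) := by
  have hxΩ : ∀ k t, 1 ≤ t → x k t ∈ Ω := by
    intro k t ht
    obtain ⟨a, rfl⟩ := Nat.exists_eq_add_of_le' ht
    cases a with
    | zero => exact hx1 k
    | succ a => rw [hxup k (a + 1) (by omega)]; exact (hproj _).1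
  set W : ℕ → ℕ → ℝ := fun k t => anhW (aodMetaR f w x k t) (aodMetaC f w x k t) with hWdef
  have hW0 : ∀ k t, 0 ≤ W k t := fun k t => anhW_nonneg (aodMetaC_nonneg f w x k t)
  have hWsum : ∀ t, 1 ≤ t → 0 < ∑ k ∈ dgcLevels T, W k t := by
    intro t ht
    refine Finset.sum_pos' (fun k _ => hW0 k t) ⟨0, zero_mem_dgcLevels hT, ?_⟩
    have hs : dgcStart 0 t = t := by simp [dgcStart]; omega
    have he : Finset.Icc t (t - 1) = ∅ := Finset.Icc_eq_empty (by omega)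
    simpa [hWdef, aodMetaR, aodMetaC, hs, he] using anhW_zero_zero_pos
  have hp0 : ∀ t, ∀ k ∈ dgcLevels T, 0 ≤ aodWeight T f w x k t := fun t k _ =>
    div_nonneg (hW0 k t) (Finset.sum_nonneg fun k _ => hW0 k t)
  have hp1 : ∀ t, 1 ≤ t → ∑ k ∈ dgcLevels T, aodWeight T f w x k t = 1 := by
    intro t ht
    simp only [aodWeight]
    rw [← Finset.sum_div]
    exact div_self (hWsum t ht).ne'
  have hwΩ : ∀ t, 1 ≤ t → w t ∈ Ω := by
    intro t ht
    rw [hw t ht]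
    exact hconv.sum_mem (hp0 t) (hp1 t ht) fun k _ => hxΩ k t ht
  have hr : ∀ k t, 1 ≤ t → |f t (w t) - f t (x k t)| ≤ 1 := by
    intro k t ht
    have h1 := hrange t _ (hwΩ t ht)
    have h2 := hrange t _ (hxΩ k t ht)
    rw [abs_le]
    constructor <;> linarith
  have hW : ∀ t, 1 ≤ t → ∑ k ∈ dgcLevels T, W k t * (f t (w t) - f t (x k t)) ≤ 0 := by
    intro t ht
    have h1 : f t (w t) ≤ ∑ k ∈ dgcLevels T, aodWeight T f w x k t * f t (x k t) := by
      have := (hfconv t).map_sum_le (hp0 t) (hp1 t ht) fun k _ => Set.mem_univ (x k t)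
      rw [← hw t ht] at this
      simpa using this
    have h2 : ∑ k ∈ dgcLevels T, aodWeight T f w x k t * f t (x k t) =
        (∑ k ∈ dgcLevels T, W k t * f t (x k t)) / ∑ k ∈ dgcLevels T, W k t := by
      rw [Finset.sum_div]
      exact Finset.sum_congr rfl fun k _ => div_mul_eq_mul_div _ _ _
    rw [h2, le_div_iff₀ (hWsum t ht), Finset.mul_sum] at h1
    have h3 : ∑ k ∈ dgcLevels T, W k t * (f t (w t) - f t (x k t)) =
        ∑ k ∈ dgcLevels T, f t (w t) * W k t - ∑ k ∈ dgcLevels T, W k t * f t (x k t) := by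
      rw [← Finset.sum_sub_distrib]
      exact Finset.sum_congr rfl fun k _ => by ring
    linarith
  obtain ⟨z₀, hz₀⟩ := hne
  have hD0 : 0 ≤ D := (norm_nonneg _).trans (hdiam z₀ hz₀ z₀ hz₀)
  have hG0 : 0 ≤ G := (norm_nonneg _).trans (hgrad 0 z₀ hz₀)
  have hwindow : ∀ v ∈ Ω, ∀ a n, a + n ≤ T →
      ∑ t ∈ Finset.Icc (a + 1) (a + n), (f t (w t) - f t v) ≤
        8 * (√(3 * cAOD T T) + D * G) * √(n : ℝ) := by
    intro v hv a n han
    set S : ℕ → ℝ := fun n => ∑ t ∈ Finset.Icc 1 n, (f t (w t) - f t v) with hS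
    have hsub : ∀ a n, S (a + n) - S a =
        ∑ t ∈ Finset.Icc (a + 1) (a + n), (f t (w t) - f t v) := by
      intro a n
      induction n with
      | zero => simp
      | succ n ih =>
        rw [← add_assoc, Finset.sum_Icc_succ_top (by omega), ← ih]
        simp only [hS]
        rw [Finset.sum_Icc_succ_top (by omega)]
        ring
    rw [← hsub]
    refine sub_le_of_dyadic (by positivity) (fun k i hi => ?_) a n han
    have hend : (i + 1) * 2 ^ k = i * 2 ^ k + 2 ^ k := by ring
    have h1 := aod_meta_regret_le f w x hr hW hi
    have h2 := ogd_regret_le (η := D / (G * √((2 : ℝ) ^ k))) (n := 2 ^ k) hconv hdiam hfconv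
      hfdiff hgrad hproj (hxΩ k) (hxup k) (by push_cast; rfl) Nat.one_le_two_pow hv (i * 2 ^ k)
    rw [← hend] at h2
    push_cast at h2
    have h3 := add_le_add h1 h2
    rw [← Finset.sum_add_distrib, ← add_mul] at h3
    rw [hend, hsub, ← hend]
    simpa using h3
  refine csSup_le ⟨_, 1, le_rfl, by omega, rfl⟩ ?_
  rintro _ ⟨s, hs1, hsT, rfl⟩
  obtain ⟨a, rfl⟩ := Nat.exists_eq_add_of_le' hs1
  have he : a + 1 + τ - 1 = a + τ := by omega
  rw [he] at hsT ⊢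
  rw [sub_le_comm]
  refine le_csInf ⟨_, z₀, hz₀, rfl⟩ ?_
  rintro _ ⟨v, hv, rfl⟩
  have := hwindow v hv a τ hsT
  rw [Finset.sum_sub_distrib] at this
  dsimp only
  linarith
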